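/- Let H be a strictly 2-balanced graph with m_2(H) > 1 that is not isomorphic to K_3. Then H is spacious: for every edge e of H there exists an edge f of H which is vertex-disjoint from e. -/

import Mathlib

open SimpleGraph Filter

/-- `f` is the vertex map of a copy of `H` inside `G`. -/
def GraphCopy {V W : Type*} (H : SimpleGraph W) (G : SimpleGraph V) (f : W ↪ V) : Prop :=
  ∀ ⦃x y : W⦄, H.Adj x y → G.Adj (f x) (f y)

/-- The colouring `χ` admits a monochromatic copy of `H` in `G`. -/
def HasMonoCopy {V W β : Type*} (H : SimpleGraph W) (G : SimpleGraph V)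
    (χ : Sym2 V → β) : Prop :=
  ∃ f : W ↪ V, GraphCopy H G f ∧
    ∀ e ∈ H.edgeSet, ∀ e' ∈ H.edgeSet, χ (Sym2.map (⇑f) e) = χ (Sym2.map (⇑f) e')

/-- The colouring `χ` admits a rainbow copy of `H` in `G`. -/
def HasRainbowCopy {V W β : Type*} (H : SimpleGraph W) (G : SimpleGraph V)
    (χ : Sym2 V → β) : Prop :=
  ∃ f : W ↪ V, GraphCopy H G f ∧
    ∀ e ∈ H.edgeSet, ∀ e' ∈ H.edgeSet, e ≠ e' → χ (Sym2.map (⇑f) e) ≠ χ (Sym2.map (⇑f) e')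

/-- `G` has the constrained Ramsey property for `(H₁, H₂)`. -/
def ConstrainedRamsey {V W₁ W₂ : Type*} (G : SimpleGraph V)
    (H₁ : SimpleGraph W₁) (H₂ : SimpleGraph W₂) : Prop :=
  ∀ (β : Type) (χ : Sym2 V → β), HasMonoCopy H₁ G χ ∨ HasRainbowCopy H₂ G χ

/-- `χ` is a proper edge-colouring of `G`. -/
def ProperEdgeColoring {V β : Type*} (G : SimpleGraph V) (χ : Sym2 V → β) : Prop :=
  ∀ e ∈ G.edgeSet, ∀ e' ∈ G.edgeSet, e ≠ e' → (∃ v, v ∈ e ∧ v ∈ e') → χ e ≠ χ e'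

/-- `G` has the anti-Ramsey property for `H`. -/
def AntiRamsey {V W : Type*} (G : SimpleGraph V) (H : SimpleGraph W) : Prop :=
  ∀ (β : Type) (χ : Sym2 V → β), ProperEdgeColoring G χ → HasRainbowCopy H G χ

/-- The value `d₂` computed from the number of edges `e` and vertices `v`. -/
noncomputable def d2val (e v : ℕ) : ℝ :=
  if 1 ≤ e ∧ 3 ≤ v then ((e : ℝ) - 1) / ((v : ℝ) - 2)
  else if e = 1 ∧ v = 2 then 1 / 2
  else 0

/-- `m(G)`: the maximum of `e(J)/v(J)` over subgraphs `J` of `G` with at least one vertex. -/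
noncomputable def maxDensity {V : Type*} (G : SimpleGraph V) : ℝ :=
  sSup {x : ℝ | ∃ J : G.Subgraph, J.verts.Nonempty ∧
    x = (J.edgeSet.ncard : ℝ) / (J.verts.ncard : ℝ)}

/-- `m₂(G)`: the maximum of `d₂(J)` over subgraphs `J` of `G`. -/
noncomputable def twoDensity {V : Type*} (G : SimpleGraph V) : ℝ :=
  sSup {x : ℝ | ∃ J : G.Subgraph, x = d2val J.edgeSet.ncard J.verts.ncard}

/-- `G` is strictly 2-balanced. -/
def StrictlyTwoBalanced {V : Type*} (G : SimpleGraph V) : Prop :=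
  ∀ J : G.Subgraph, J ≠ ⊤ →
    d2val J.edgeSet.ncard J.verts.ncard < d2val G.edgeSet.ncard (Nat.card V)

/-- The star `K_{1,k}` with centre `0`. -/
def starGraph (k : ℕ) : SimpleGraph (Fin (k + 1)) :=
  SimpleGraph.fromRel (fun i _ => i = 0)

/-- The minimum degree `δ(G)`. -/
noncomputable def minDeg {V : Type*} (G : SimpleGraph V) : ℕ :=
  sInf {d : ℕ | ∃ v : V, d = (G.neighborSet v).ncard}

noncomputable instance (n : ℕ) : Fintype (SimpleGraph (Fin n)) :=
  Fintype.ofInjective (fun G : SimpleGraph (Fin n) => G.edgeSet)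
    fun _ _ h => SimpleGraph.edgeSet_inj.mp h

open Classical in
/-- The probability that `G(n,p)` satisfies the property `P`. -/
noncomputable def grProb (n : ℕ) (p : ℝ) (P : SimpleGraph (Fin n) → Prop) : ℝ :=
  ∑ G : SimpleGraph (Fin n),
    if P G then p ^ G.edgeSet.ncard * (1 - p) ^ (n.choose 2 - G.edgeSet.ncard) else 0

/-- `s` is the vertex set of a triangle of `T`. -/
def IsTriangleSet {V : Type*} (T : SimpleGraph V) (s : Set V) : Prop :=
  ∃ x y z : V, T.Adj x y ∧ T.Adj x z ∧ T.Adj y z ∧ s = {x, y, z}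

/-- `T` is triangle-connected. -/
def TriangleConnected {V : Type*} (T : SimpleGraph V) : Prop :=
  (∀ v : V, ∃ w, T.Adj v w) ∧
  (∀ u v : V, T.Adj u v → ∃ w, T.Adj u w ∧ T.Adj v w) ∧
  (∀ s t : Set V, IsTriangleSet T s → IsTriangleSet T t →
    Relation.ReflTransGen
      (fun x y : Set V => IsTriangleSet T x ∧ IsTriangleSet T y ∧ (x ∩ y).ncard = 2) s t)

/-- A triangle sequence `T₀, …, T_ℓ` in `T`, together with the chosen vertices `v i`
and base edges `a i`–`b i`. -/
structure TriangleSeq {V : Type*} (T : SimpleGraph V) (ℓ : ℕ) where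
  G : ℕ → T.Subgraph
  v : ℕ → V
  a : ℕ → V
  b : ℕ → V
  init : ∃ x y z : V, ∃ (hxy : T.Adj x y) (hxz : T.Adj x z) (hyz : T.Adj y z),
    G 0 = T.subgraphOfAdj hxy ⊔ T.subgraphOfAdj hxz ⊔ T.subgraphOfAdj hyz
  newVert : ∀ i, 1 ≤ i → i ≤ ℓ → v i ∉ (G (i - 1)).verts
  baseEdge : ∀ i, 1 ≤ i → i ≤ ℓ →
    (G (i - 1)).Adj (a i) (b i) ∧ T.Adj (v i) (a i) ∧ T.Adj (v i) (b i)
  vertsEq : ∀ i, 1 ≤ i → i ≤ ℓ → (G i).verts = (G (i - 1)).verts ∪ {v i}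
  adjEq : ∀ i, 1 ≤ i → i ≤ ℓ → ∀ x y : V, (G i).Adj x y ↔
    ((G (i - 1)).Adj x y ∨ (x = v i ∧ y ∈ (G (i - 1)).verts ∧ T.Adj x y)
      ∨ (y = v i ∧ x ∈ (G (i - 1)).verts ∧ T.Adj x y))

/-- `deg(v_i, T_{i-1})`: the number of neighbours of `v i` (in `T`) inside `T_{i-1}`. -/
noncomputable def TriangleSeq.deg {V : Type*} {T : SimpleGraph V} {ℓ : ℕ}
    (s : TriangleSeq T ℓ) (i : ℕ) : ℕ :=
  ((s.G (i - 1)).verts ∩ T.neighborSet (s.v i)).ncard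

/-- `r(T₀, …, T_ℓ) = Σ_{i ∈ [ℓ]} (deg(v_i, T_{i-1}) − 2)`. -/
noncomputable def TriangleSeq.r {V : Type*} {T : SimpleGraph V} {ℓ : ℕ}
    (s : TriangleSeq T ℓ) : ℤ :=
  ∑ i ∈ Finset.Icc 1 ℓ, ((s.deg i : ℤ) - 2)

/-- Step `i` is regular. -/
def TriangleSeq.Regular {V : Type*} {T : SimpleGraph V} {ℓ : ℕ}
    (s : TriangleSeq T ℓ) (i : ℕ) : Prop :=
  s.deg i = 2

/-- A `ρ`-minimal triangle sequence. -/
def RhoMinimal {V : Type*} {T : SimpleGraph V} {ℓ : ℕ} (ρ : ℕ)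
    (s : TriangleSeq T ℓ) : Prop :=
  (ρ : ℤ) ≤ s.r ∧ ∀ (ℓ' : ℕ) (s' : TriangleSeq T ℓ'), (ρ : ℤ) ≤ s'.r → ¬ s'.G ℓ' < s.G ℓ


theorem twoDensity_le_of_strictlyTwoBalanced {V : Type*} (H : SimpleGraph V)
    (hbal : StrictlyTwoBalanced H) :
    twoDensity H ≤ d2val H.edgeSet.ncard (Nat.card V) := by
  refine csSup_le ⟨_, ⊤, rfl⟩ ?_
  rintro x ⟨J, rfl⟩
  by_cases hJ : J = ⊤
  · subst hJ
    simp [Set.ncard_univ]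
  · exact (hbal J hJ).le

theorem d2val_of_three_le {e v : ℕ} (he : 1 ≤ e) (hv : 3 ≤ v) :
    d2val e v = ((e : ℝ) - 1) / ((v : ℝ) - 2) :=
  if_pos ⟨he, hv⟩

theorem three_le_and_le_of_one_lt_d2val {e v : ℕ} (h : 1 < d2val e v) : 3 ≤ v ∧ v ≤ e := by
  by_cases hev : 1 ≤ e ∧ 3 ≤ v
  · refine ⟨hev.2, ?_⟩
    have hv : (3 : ℝ) ≤ v := by exact_mod_cast hev.2
    rw [d2val_of_three_le hev.1 hev.2, lt_div_iff₀ (by linarith)] at h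
    have h' : (v : ℝ) < e + 1 := by linarith
    exact Nat.lt_succ_iff.mp (by exact_mod_cast h')
  · rw [d2val, if_neg hev] at h
    split_ifs at h <;> norm_num at h

theorem SimpleGraph.eq_or_exists_of_edge_meets_all {V : Type*} {H : SimpleGraph V} {u v : V}
    (hmeet : ∀ f ∈ H.edgeSet, ∃ x ∈ s(u, v), x ∈ f) {f : Sym2 V} (hf : f ∈ H.edgeSet) :
    f = s(u, v) ∨ ∃ w ∈ ({u, v}ᶜ : Set V), (H.Adj u w ∧ f = s(u, w)) ∨
      (H.Adj v w ∧ f = s(v, w)) := by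
  obtain ⟨x, hx, w, rfl⟩ := hmeet f hf
  rw [SimpleGraph.mem_edgeSet] at hf
  by_cases hw : w ∈ ({u, v} : Set V)
  · left
    have := hf.ne
    simp only [Sym2.mem_iff, Set.mem_insert_iff, Set.mem_singleton_iff] at hx hw
    rcases hx with rfl | rfl <;> rcases hw with rfl | rfl <;> simp_all [Sym2.eq_swap]
  · right
    refine ⟨w, hw, ?_⟩
    rcases Sym2.mem_iff.mp hx with rfl | rfl
    · exact Or.inl ⟨hf, rfl⟩
    · exact Or.inr ⟨hf, rfl⟩

theorem Set.ncard_compl_pair {V : Type*} [Finite V] {u v : V} (huv : u ≠ v) :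
    ({u, v}ᶜ : Set V).ncard = Nat.card V - 2 := by
  rw [Set.ncard_compl, Set.ncard_pair huv]

theorem SimpleGraph.ncard_edgeSet_le_of_edge_meets_all {V : Type*} [Finite V]
    {H : SimpleGraph V} {u v : V} (huv : u ≠ v)
    (hmeet : ∀ f ∈ H.edgeSet, ∃ x ∈ s(u, v), x ∈ f) :
    H.edgeSet.ncard ≤ 2 * (Nat.card V - 2) + 1 := by
  have hsub : H.edgeSet ⊆ insert s(u, v)
      ((fun w => s(u, w)) '' {u, v}ᶜ ∪ (fun w => s(v, w)) '' {u, v}ᶜ) := by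
    intro f hf
    rcases eq_or_exists_of_edge_meets_all hmeet hf with h | ⟨w, hw, ⟨-, h⟩ | ⟨-, h⟩⟩
    · exact Or.inl h
    · exact Or.inr (Or.inl ⟨w, hw, h.symm⟩)
    · exact Or.inr (Or.inr ⟨w, hw, h.symm⟩)
  have h₀ := Set.ncard_le_ncard hsub (Set.toFinite _)
  have h₁ := Set.ncard_insert_le s(u, v)
    ((fun w => s(u, w)) '' {u, v}ᶜ ∪ (fun w => s(v, w)) '' {u, v}ᶜ)
  have h₂ := Set.ncard_union_le ((fun w => s(u, w)) '' {u, v}ᶜ) ((fun w => s(v, w)) '' {u, v}ᶜ)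
  have h₃ := Set.ncard_image_le (f := fun w => s(u, w)) (Set.toFinite ({u, v}ᶜ : Set V))
  have h₄ := Set.ncard_image_le (f := fun w => s(v, w)) (Set.toFinite ({u, v}ᶜ : Set V))
  rw [Set.ncard_compl_pair huv] at h₃ h₄
  omega

theorem SimpleGraph.ncard_edgeSet_le_of_edge_meets_all_of_no_common_neighbor {V : Type*}
    [Finite V] {H : SimpleGraph V} {u v : V} (huv : u ≠ v)
    (hmeet : ∀ f ∈ H.edgeSet, ∃ x ∈ s(u, v), x ∈ f)
    (hcommon : ∀ w, H.Adj u w → ¬ H.Adj v w) :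
    H.edgeSet.ncard ≤ (Nat.card V - 2) + 1 := by
  classical
  let g : V → Sym2 V := fun w => if H.Adj u w then s(u, w) else s(v, w)
  have hsub : H.edgeSet ⊆ insert s(u, v) (g '' {u, v}ᶜ) := by
    intro f hf
    rcases eq_or_exists_of_edge_meets_all hmeet hf with h | ⟨w, hw, ⟨ha, h⟩ | ⟨ha, h⟩⟩
    · exact Or.inl h
    · exact Or.inr ⟨w, hw, by rw [h]; exact if_pos ha⟩
    · exact Or.inr ⟨w, hw, by rw [h]; exact if_neg fun hu => hcommon w hu ha⟩
  have h₀ := Set.ncard_le_ncard hsub (Set.toFinite _)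
  have h₁ := Set.ncard_insert_le s(u, v) (g '' {u, v}ᶜ)
  have h₂ := Set.ncard_image_le (f := g) (Set.toFinite ({u, v}ᶜ : Set V))
  rw [Set.ncard_compl_pair huv] at h₂
  omega

theorem Set.ncard_triple {α : Type*} {a b c : α} (hab : a ≠ b) (hac : a ≠ c) (hbc : b ≠ c) :
    ({a, b, c} : Set α).ncard = 3 :=
  Set.ncard_eq_three.mpr ⟨a, b, c, hab, hac, hbc, rfl⟩

theorem two_le_d2val_induce_triangle {V : Type*} [Finite V] {H : SimpleGraph V} {u v w : V}
    (huv : H.Adj u v) (huw : H.Adj u w) (hvw : H.Adj v w) :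
    2 ≤ d2val ((⊤ : H.Subgraph).induce {u, v, w}).edgeSet.ncard
      ((⊤ : H.Subgraph).induce {u, v, w}).verts.ncard := by
  have hverts : ((⊤ : H.Subgraph).induce {u, v, w}).verts.ncard = 3 :=
    Set.ncard_triple huv.ne huw.ne hvw.ne
  have hsub : {s(u, v), s(u, w), s(v, w)} ⊆ ((⊤ : H.Subgraph).induce {u, v, w}).edgeSet := by
    rintro f (rfl | rfl | rfl) <;> simp [huv, huw, hvw]
  have hedges : 3 ≤ ((⊤ : H.Subgraph).induce {u, v, w}).edgeSet.ncard := by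
    rw [← Set.ncard_triple (a := s(u, v)) (b := s(u, w)) (c := s(v, w))
      (by simp [hvw.ne, huw.ne]) (by simp [huv.ne, huw.ne]) (by simp [huv.ne, huw.ne])]
    exact Set.ncard_le_ncard hsub (Set.toFinite _)
  rw [d2val_of_three_le (by omega) hverts.ge, hverts]
  have : (3 : ℝ) ≤ ((⊤ : H.Subgraph).induce {u, v, w}).edgeSet.ncard := by exact_mod_cast hedges
  norm_num
  linarith

theorem SimpleGraph.nonempty_iso_top_fin_three {V : Type*} [Fintype V] {H : SimpleGraph V}
    {u v w : V} (huv : H.Adj u v) (huw : H.Adj u w) (hvw : H.Adj v w)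
    (huniv : ({u, v, w} : Set V) = Set.univ) :
    Nonempty (H ≃g (⊤ : SimpleGraph (Fin 3))) := by
  have hcard : Fintype.card V = 3 := by
    rw [← Nat.card_eq_fintype_card, ← Set.ncard_univ, ← huniv,
      Set.ncard_triple huv.ne huw.ne hvw.ne]
  have htop : H = ⊤ := by
    ext x y
    have hx : x ∈ ({u, v, w} : Set V) := huniv ▸ Set.mem_univ x
    have hy : y ∈ ({u, v, w} : Set V) := huniv ▸ Set.mem_univ y
    rcases hx with rfl | rfl | rfl <;> rcases hy with rfl | rfl | rfl <;>
      simp [huv, huw, hvw, huv.symm, huw.symm, hvw.symm, huv.ne, huw.ne, hvw.ne,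
        huv.ne', huw.ne', hvw.ne']
  subst htop
  exact ⟨SimpleGraph.Iso.completeGraph (Fintype.equivFinOfCardEq hcard)⟩

/-- a strictly 2-balanced graph with `m₂ > 1` other than `K₃` is spacious. -/
theorem stmt_4 {V : Type} [Fintype V] (H : SimpleGraph V)
    (hbal : StrictlyTwoBalanced H) (hm : 1 < twoDensity H)
    (hK3 : ¬ Nonempty (H ≃g (⊤ : SimpleGraph (Fin 3)))) :
    ∀ e ∈ H.edgeSet, ∃ f ∈ H.edgeSet, ∀ v : V, v ∈ e → v ∉ f := by
  intro e
  induction e with | _ u v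
  intro huv
  rw [SimpleGraph.mem_edgeSet] at huv
  by_contra! hmeet
  have hgt := hm.trans_le (twoDensity_le_of_strictlyTwoBalanced H hbal)
  obtain ⟨hn, hle⟩ := three_le_and_le_of_one_lt_d2val hgt
  by_cases hcommon : ∃ w, H.Adj u w ∧ H.Adj v w
  · obtain ⟨w, huw, hvw⟩ := hcommon
    by_cases htop : (⊤ : H.Subgraph).induce {u, v, w} = ⊤
    · exact hK3 (nonempty_iso_top_fin_three huv huw hvw
        (congrArg SimpleGraph.Subgraph.verts htop))
    · have hlt := (two_le_d2val_induce_triangle huv huw hvw).trans_lt (hbal _ htop)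
      have hn' : (3 : ℝ) ≤ Nat.card V := by exact_mod_cast hn
      rw [d2val_of_three_le (by omega) hn, lt_div_iff₀ (by linarith)] at hlt
      have hedges : H.edgeSet.ncard + 3 ≤ 2 * Nat.card V := by
        have := ncard_edgeSet_le_of_edge_meets_all huv.ne hmeet
        omega
      have : (H.edgeSet.ncard : ℝ) + 3 ≤ 2 * Nat.card V := by exact_mod_cast hedges
      linarith
  · push Not at hcommon
    have := ncard_edgeSet_le_of_edge_meets_all_of_no_common_neighbor huv.ne hmeet hcommon
    omega
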